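/- arXiv:2506.02881 — 2 statements merged into one kernel-verified Lean document; each statement's English description precedes it below -/
import Mathlib

section
/- Let θ*, θ₀ ∈ ℝ with θ₀ ≠ θ*, let B ∈ ℕ with B ≥ 1, and let ρ_T and ρ_T^{(i)} (for i = 1,…,B and T ∈ ℕ) be real-valued random variables on a common probability space such that ρ_T → θ* almost surely as T → ∞ and, for each i ∈ {1,…,B}, ρ_T^{(i)} → θ₀ almost surely as T → ∞. Define F̂_T = (1/B) ∑_{i=1}^B 1[ρ_T ≤ ρ_T^{(i)}]. Then almost surely there exists T₀ such that F̂_T ∈ {0, 1} for all T ≥ T₀; consequently, for every α ∈ (0,1), the probability of the event {F̂_T < α/2 or F̂_T > 1 − α/2} (i.e., that the simulation-based test rejects the null θ = θ₀) converges to 1 as T → ∞. -/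
open MeasureTheory ProbabilityTheory Filter Set

/-- The measure of a sequence of events that almost surely occur eventually tends to one. -/
theorem tendsto_measure_one_of_ae_eventually_mem
    {Ω : Type*} [MeasurableSpace Ω] (P : Measure Ω) [IsProbabilityMeasure P]
    {A : ℕ → Set Ω} (hA : ∀ T, MeasurableSet (A T))
    (h : ∀ᵐ ω ∂P, ∀ᶠ T in atTop, ω ∈ A T) :
    Tendsto (fun T => P (A T)) atTop (nhds 1) := by
  rw [← measure_univ (μ := P)]
  refine tendsto_measure_of_ae_tendsto_indicator_of_isFiniteMeasure atTop MeasurableSet.univ hA ?_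
  filter_upwards [h] with ω hω
  filter_upwards [hω] with T hT
  simpa using hT

/-- If `a` and the finitely many `b i` converge to distinct limits, then the proportion of
indices with `a T ≤ b i T` is eventually `0` or `1`. -/
theorem eventually_proportion_le_eq_zero_or_one {B : ℕ} (hB : 1 ≤ B) {x y : ℝ} (hne : y ≠ x)
    {a : ℕ → ℝ} {b : Fin B → ℕ → ℝ} (ha : Tendsto a atTop (nhds x))
    (hb : ∀ i, Tendsto (b i) atTop (nhds y)) :
    ∀ᶠ T in atTop,
      (1 / (B : ℝ)) * (∑ i : Fin B, if a T ≤ b i T then (1 : ℝ) else 0) = 0 ∨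
      (1 / (B : ℝ)) * (∑ i : Fin B, if a T ≤ b i T then (1 : ℝ) else 0) = 1 := by
  have hB' : (B : ℝ) ≠ 0 := by positivity
  rcases lt_or_gt_of_ne hne with hlt | hgt
  · filter_upwards [eventually_all.2 fun i => (hb i).eventually_lt ha hlt] with T hT
    left
    simp [fun i => not_le.2 (hT i)]
  · filter_upwards [eventually_all.2 fun i => ha.eventually_lt (hb i) hgt] with T hT
    right
    simp [fun i => (hT i).le, hB']

/-- **Test of power one.** If the observed statistic `ρ T` converges a.s. to the true
parameter `θstar` and each of the `B` simulated statistics `ρsim i T` converges a.s. to the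
null value `θ0 ≠ θstar`, then the empirical CDF `Fhat T` of the simulated statistics evaluated
at the observed statistic is eventually in `{0, 1}` almost surely, and for each `α ∈ (0,1)`
the probability that the test rejects (i.e. `Fhat T < α/2` or `Fhat T > 1 - α/2`) tends to 1. -/
theorem simulation_test_power_one
    {Ω : Type*} [MeasurableSpace Ω] (P : Measure Ω) [IsProbabilityMeasure P]
    (θstar θ0 : ℝ) (hne : θ0 ≠ θstar)
    (B : ℕ) (hB : 1 ≤ B)
    (ρ : ℕ → Ω → ℝ) (ρsim : Fin B → ℕ → Ω → ℝ)
    (hρmeas : ∀ T, Measurable (ρ T)) (hρsimmeas : ∀ i T, Measurable (ρsim i T))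
    (hρ : ∀ᵐ ω ∂P, Tendsto (fun T => ρ T ω) atTop (nhds θstar))
    (hsim : ∀ i : Fin B, ∀ᵐ ω ∂P, Tendsto (fun T => ρsim i T ω) atTop (nhds θ0))
    (Fhat : ℕ → Ω → ℝ)
    (hFhat : ∀ T ω, Fhat T ω
      = (1 / (B : ℝ)) * ∑ i : Fin B, if ρ T ω ≤ ρsim i T ω then (1 : ℝ) else 0) :
    (∀ᵐ ω ∂P, ∃ T₀ : ℕ, ∀ T ≥ T₀, Fhat T ω = 0 ∨ Fhat T ω = 1) ∧
    (∀ α : ℝ, α ∈ Set.Ioo (0 : ℝ) 1 →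
      Tendsto (fun T => P {ω | Fhat T ω < α / 2 ∨ 1 - α / 2 < Fhat T ω}) atTop (nhds 1)) := by
  have hev : ∀ᵐ ω ∂P, ∀ᶠ T in atTop, Fhat T ω = 0 ∨ Fhat T ω = 1 := by
    filter_upwards [hρ, ae_all_iff.2 hsim] with ω hω hsimω
    simpa only [hFhat] using eventually_proportion_le_eq_zero_or_one hB hne hω hsimω
  have hmeas : ∀ T, Measurable (Fhat T) := fun T => by
    rw [funext (hFhat T)]
    exact (Finset.measurable_fun_sum _ fun i _ => Measurable.ite
      (measurableSet_le (hρmeas T) (hρsimmeas i T)) measurable_const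
      measurable_const).const_mul _
  refine ⟨hev.mono fun ω hω => eventually_atTop.1 hω, fun α hα => ?_⟩
  refine tendsto_measure_one_of_ae_eventually_mem P (fun T =>
    (measurableSet_lt (hmeas T) measurable_const).union
      (measurableSet_lt measurable_const (hmeas T))) ?_
  filter_upwards [hev] with ω hω
  filter_upwards [hω] with T hT
  rcases hT with hT | hT
  · left
    linarith [hα.1]
  · right
    linarith [hα.1]
end

section
/- Let θ* ∈ ℝ, let Θ₀ ⊂ ℝ be a finite set with θ* ∈ Θ₀, let B ∈ ℕ with B ≥ 1, and let ρ_T and ρ_T^{(i)}(θ₀) (for i = 1,…,B, θ₀ ∈ Θ₀, T ∈ ℕ) be real-valued random variables on a common probability space such that ρ_T → θ* almost surely as T → ∞ and, for each i and each θ₀ ∈ Θ₀, ρ_T^{(i)}(θ₀) → θ₀ almost surely as T → ∞. For α ∈ (0,1) set F̂_T(θ₀) = (1/B) ∑_{i=1}^B 1[ρ_T ≤ ρ_T^{(i)}(θ₀)] and define the confidence set Ĉ_T(α) = {ρ_T} ∪ {θ₀ ∈ Θ₀ : α/2 ≤ F̂_T(θ₀) ≤ 1 − α/2}. Then almost surely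 sup_{θ ∈ Ĉ_T(α)} |θ − θ*| → 0 as T → ∞ (so the confidence set converges to the singleton {θ*}), and any sequence of measurable selections θ̂_T ∈ Ĉ_T(α) converges to θ* almost surely. -/
open MeasureTheory ProbabilityTheory Filter Set

/-- If `r` tends to `a` and finitely many sequences `x i` all tend to some `b ≠ a`, then the
proportion of indices with `r T ≤ x i T` is eventually `0` or `1`, hence eventually outside
`[α / 2, 1 - α / 2]`. -/
lemma eventually_not_mem_acceptance {B : ℕ} (hB : 1 ≤ B) {r : ℕ → ℝ} {x : Fin B → ℕ → ℝ}
    {a b α : ℝ} (hα : 0 < α) (hab : b ≠ a) (hr : Tendsto r atTop (nhds a))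
    (hx : ∀ i, Tendsto (x i) atTop (nhds b)) :
    ∀ᶠ T in atTop,
      ¬(α / 2 ≤ (1 / (B : ℝ)) * ∑ i : Fin B, (if r T ≤ x i T then (1 : ℝ) else 0) ∧
        (1 / (B : ℝ)) * ∑ i : Fin B, (if r T ≤ x i T then (1 : ℝ) else 0) ≤ 1 - α / 2) := by
  have hB0 : (B : ℝ) ≠ 0 := by
    exact_mod_cast Nat.one_le_iff_ne_zero.mp hB
  rcases lt_or_gt_of_ne hab with h | h
  · have hlt : ∀ᶠ T in atTop, ∀ i, x i T < r T :=
      eventually_all.2 fun i => (hx i).eventually_lt hr h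
    filter_upwards [hlt] with T hT
    have hsum : ∑ i : Fin B, (if r T ≤ x i T then (1 : ℝ) else 0) = 0 :=
      Finset.sum_eq_zero fun i _ => if_neg (not_le.2 (hT i))
    rw [hsum, mul_zero]
    rintro ⟨h1, -⟩
    linarith
  · have hlt : ∀ᶠ T in atTop, ∀ i, r T < x i T :=
      eventually_all.2 fun i => hr.eventually_lt (hx i) h
    filter_upwards [hlt] with T hT
    have hsum : ∑ i : Fin B, (if r T ≤ x i T then (1 : ℝ) else 0) = B := by
      simp [fun i => (hT i).le]
    rw [hsum, one_div_mul_cancel hB0]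
    rintro ⟨-, h2⟩
    linarith

/-- **Convergence of the confidence set and point estimate.** If the observed statistic
`ρ T` converges a.s. to `θstar ∈ Θ0` and, for each null value `θ0` in the finite grid `Θ0`,
each of the `B` simulated statistics `ρsim i θ0 T` converges a.s. to `θ0`, then the confidence
set `C T ω = {ρ T ω} ∪ {θ0 ∈ Θ0 : α/2 ≤ Fhat θ0 T ω ≤ 1 - α/2}` converges a.s. to the
singleton `{θstar}` (in the sense that `sup_{θ ∈ C T ω} |θ - θstar| → 0`), and any sequence of
measurable selections from it converges a.s. to `θstar`. -/
theorem simulation_confidence_set_converges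
    {Ω : Type*} [MeasurableSpace Ω] (P : Measure Ω) [IsProbabilityMeasure P]
    (θstar : ℝ) (Θ0 : Finset ℝ) (hθstar : θstar ∈ Θ0)
    (B : ℕ) (hB : 1 ≤ B)
    (ρ : ℕ → Ω → ℝ) (ρsim : Fin B → ℝ → ℕ → Ω → ℝ)
    (hρmeas : ∀ T, Measurable (ρ T)) (hρsimmeas : ∀ i θ0 T, Measurable (ρsim i θ0 T))
    (hρ : ∀ᵐ ω ∂P, Tendsto (fun T => ρ T ω) atTop (nhds θstar))
    (hsim : ∀ i : Fin B, ∀ θ0 ∈ Θ0,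
      ∀ᵐ ω ∂P, Tendsto (fun T => ρsim i θ0 T ω) atTop (nhds θ0))
    (α : ℝ) (hα : α ∈ Set.Ioo (0 : ℝ) 1)
    (Fhat : ℝ → ℕ → Ω → ℝ)
    (hFhat : ∀ θ0 T ω, Fhat θ0 T ω
      = (1 / (B : ℝ)) * ∑ i : Fin B, if ρ T ω ≤ ρsim i θ0 T ω then (1 : ℝ) else 0)
    (C : ℕ → Ω → Set ℝ)
    (hC : ∀ T ω, C T ω
      = insert (ρ T ω)
          {θ0 | θ0 ∈ Θ0 ∧ α / 2 ≤ Fhat θ0 T ω ∧ Fhat θ0 T ω ≤ 1 - α / 2}) :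
    (∀ᵐ ω ∂P,
      Tendsto (fun T => sSup ((fun θ => |θ - θstar|) '' C T ω)) atTop (nhds 0)) ∧
    (∀ θhat : ℕ → Ω → ℝ, (∀ T, Measurable (θhat T)) → (∀ T ω, θhat T ω ∈ C T ω) →
      ∀ᵐ ω ∂P, Tendsto (fun T => θhat T ω) atTop (nhds θstar)) := by
  have key : ∀ᵐ ω ∂P, Tendsto (fun T => |ρ T ω - θstar|) atTop (nhds 0) ∧
      ∀ᶠ T in atTop, ∀ θ ∈ C T ω, |θ - θstar| ≤ |ρ T ω - θstar| := by
    have hsim' : ∀ᵐ ω ∂P, ∀ i : Fin B, ∀ θ0 ∈ Θ0,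
        Tendsto (fun T => ρsim i θ0 T ω) atTop (nhds θ0) :=
      ae_all_iff.2 fun i => (ae_ball_iff Θ0.countable_toSet).2 (hsim i)
    filter_upwards [hρ, hsim'] with ω hρω hsimω
    refine ⟨by simpa using (hρω.sub_const θstar).abs, ?_⟩
    have hrej : ∀ᶠ T in atTop, ∀ θ0 ∈ Θ0, θ0 ≠ θstar →
        ¬(α / 2 ≤ Fhat θ0 T ω ∧ Fhat θ0 T ω ≤ 1 - α / 2) := by
      rw [Filter.eventually_all_finset]
      intro θ0 hθ0
      by_cases hne : θ0 = θstar
      · exact Eventually.of_forall fun T h => absurd hne h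
      · filter_upwards [eventually_not_mem_acceptance hB hα.1 hne hρω
          fun i => hsimω i θ0 hθ0] with T hT _
        rwa [hFhat]
    filter_upwards [hrej] with T hT θ hθ
    rw [hC] at hθ
    rcases hθ with rfl | ⟨hθ0, hacc⟩
    · exact le_rfl
    · have hθeq : θ = θstar := by
        by_contra hne
        exact hT θ hθ0 hne hacc
      simp [hθeq]
  constructor
  · filter_upwards [key] with ω ⟨hlim, hbound⟩
    refine squeeze_zero' (Eventually.of_forall fun T => Real.sSup_nonneg ?_) ?_ hlim
    · rintro _ ⟨θ, -, rfl⟩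
      exact abs_nonneg _
    · filter_upwards [hbound] with T hT
      refine Real.sSup_le ?_ (abs_nonneg _)
      rintro _ ⟨θ, hθ, rfl⟩
      exact hT θ hθ
  · intro θhat _ hmem
    filter_upwards [key] with ω ⟨hlim, hbound⟩
    rw [tendsto_iff_dist_tendsto_zero]
    refine squeeze_zero' (Eventually.of_forall fun T => dist_nonneg) ?_ hlim
    filter_upwards [hbound] with T hT
    exact hT _ (hmem T ω)
end
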